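/- For any unital ring R, the category Ch₊(R) of non-negatively graded chain complexes of left R-modules carries a cofibrantly generated model structure in which the weak equivalences are the quasi-isomorphisms, the fibrations are the chain maps that are surjective in all strictly positive degrees, and the cofibrations are the injective chain maps with degree-wise projective cokernel. -/

import Mathlib

open CategoryTheory Limits

universe v u

/-- `g` is a retract of `f` in the arrow category. -/
def IsRetractOf {C : Type u} [Category.{v} C] {X Y A B : C} (g : X ⟶ Y) (f : A ⟶ B) : Prop :=
  ∃ (i : X ⟶ A) (r : A ⟶ X) (j : Y ⟶ B) (s : B ⟶ Y),
    i ≫ r = 𝟙 X ∧ j ≫ s = 𝟙 Y ∧ i ≫ f = g ≫ j ∧ f ≫ s = r ≫ g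

/-- The class of morphisms having the right lifting property with respect to `S`. -/
def rlpOf {C : Type u} [Category.{v} C] (S : MorphismProperty C) : MorphismProperty C :=
  fun _ _ p => ∀ ⦃A B : C⦄ (i : A ⟶ B), S i → HasLiftingProperty i p

/-- A (Quillen) model structure on a category `C`, given by its weak equivalences,
fibrations and cofibrations, satisfying the usual axioms. -/
structure ModelStructure (C : Type u) [Category.{v} C] where
  weq : MorphismProperty C
  fib : MorphismProperty C
  cof : MorphismProperty C
  weq_of_iso : ∀ {X Y : C} (f : X ⟶ Y), IsIso f → weq f
  weq_comp : ∀ {X Y Z : C} (f : X ⟶ Y) (g : Y ⟶ Z), weq f → weq g → weq (f ≫ g)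
  weq_of_comp_left : ∀ {X Y Z : C} (f : X ⟶ Y) (g : Y ⟶ Z), weq f → weq (f ≫ g) → weq g
  weq_of_comp_right : ∀ {X Y Z : C} (f : X ⟶ Y) (g : Y ⟶ Z), weq g → weq (f ≫ g) → weq f
  weq_retract : ∀ {X Y A B : C} (g : X ⟶ Y) (f : A ⟶ B), IsRetractOf g f → weq f → weq g
  fib_retract : ∀ {X Y A B : C} (g : X ⟶ Y) (f : A ⟶ B), IsRetractOf g f → fib f → fib g
  cof_retract : ∀ {X Y A B : C} (g : X ⟶ Y) (f : A ⟶ B), IsRetractOf g f → cof f → cof g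
  lift_cof_trivFib : ∀ {A B X Y : C} (i : A ⟶ B) (p : X ⟶ Y),
    cof i → fib p → weq p → HasLiftingProperty i p
  lift_trivCof_fib : ∀ {A B X Y : C} (i : A ⟶ B) (p : X ⟶ Y),
    cof i → weq i → fib p → HasLiftingProperty i p
  fact_trivCof_fib : ∀ {X Y : C} (f : X ⟶ Y),
    ∃ (Z : C) (i : X ⟶ Z) (p : Z ⟶ Y), cof i ∧ weq i ∧ fib p ∧ i ≫ p = f
  fact_cof_trivFib : ∀ {X Y : C} (f : X ⟶ Y),
    ∃ (Z : C) (i : X ⟶ Z) (p : Z ⟶ Y), cof i ∧ fib p ∧ weq p ∧ i ≫ p = f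

/-- A model structure is cofibrantly generated by sets `I` (generating cofibrations) and
`J` (generating trivial cofibrations) if the fibrations are precisely the maps with the
right lifting property with respect to `J`, and the trivial fibrations are precisely the
maps with the right lifting property with respect to `I`. -/
structure IsCofibrantlyGenerated {C : Type u} [Category.{v} C] (M : ModelStructure C)
    (I J : MorphismProperty C) : Prop where
  fib_iff : ∀ {X Y : C} (p : X ⟶ Y), M.fib p ↔ rlpOf J p
  trivFib_iff : ∀ {X Y : C} (p : X ⟶ Y), (M.fib p ∧ M.weq p) ↔ rlpOf I p

namespace ProjectiveModelStructure

variable {R : Type u} [Ring R]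

/-- An element of a chain complex is a cycle if all differentials vanish on it. -/
def IsCycle (X : ChainComplex (ModuleCat.{u} R) ℕ) {n : ℕ} (x : X.X n) : Prop :=
  ∀ j, X.d n j x = 0

lemma isCycle_zero_degree (X : ChainComplex (ModuleCat.{u} R) ℕ) (x : X.X 0) : IsCycle X x := by
  intro j
  rw [X.shape 0 j (by simp)]
  rfl

lemma d_d_apply (X : ChainComplex (ModuleCat.{u} R) ℕ) {i j k : ℕ} (x : X.X i) :
    X.d j k (X.d i j x) = 0 :=
  ConcreteCategory.congr_hom (X.d_comp_d i j k) x

lemma isCycle_d (X : ChainComplex (ModuleCat.{u} R) ℕ) {i j : ℕ} (x : X.X i) :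
    IsCycle X (X.d i j x) := fun _ => d_d_apply X x

lemma isCycle_succ_iff (X : ChainComplex (ModuleCat.{u} R) ℕ) {n : ℕ} (x : X.X (n + 1)) :
    IsCycle X x ↔ X.d (n + 1) n x = 0 := by
  refine ⟨fun h => h n, fun h j => ?_⟩
  by_cases hj : j = n
  · subst hj
    exact h
  · rw [X.shape (n + 1) j (by simpa using hj)]
    rfl

lemma IsCycle.zero (X : ChainComplex (ModuleCat.{u} R) ℕ) {n : ℕ} : IsCycle X (0 : X.X n) :=
  fun _ => map_zero _

lemma IsCycle.add {X : ChainComplex (ModuleCat.{u} R) ℕ} {n : ℕ} {x y : X.X n}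
    (hx : IsCycle X x) (hy : IsCycle X y) : IsCycle X (x + y) := fun j => by
  rw [map_add, hx j, hy j, add_zero]

lemma d_f_apply {X Y : ChainComplex (ModuleCat.{u} R) ℕ} (f : X ⟶ Y) {i j : ℕ} (x : X.X i) :
    Y.d i j (f.f i x) = f.f j (X.d i j x) :=
  ConcreteCategory.congr_hom (f.comm i j) x

lemma IsCycle.map {X Y : ChainComplex (ModuleCat.{u} R) ℕ} (f : X ⟶ Y) {n : ℕ} {x : X.X n}
    (hx : IsCycle X x) : IsCycle Y (f.f n x) := fun j => by
  rw [d_f_apply, hx j, map_zero]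

lemma isCycle_iCycles (X : ChainComplex (ModuleCat.{u} R) ℕ) {n : ℕ} (c : X.cycles n) :
    IsCycle X (X.iCycles n c) := fun j =>
  ConcreteCategory.congr_hom (X.iCycles_d n j) c

lemma exists_cycles_of_isCycle (X : ChainComplex (ModuleCat.{u} R) ℕ) {n : ℕ} {x : X.X n}
    (hx : IsCycle X x) : ∃ c : X.cycles n, X.iCycles n c = x := by
  have h : (ShortComplex.mk _ _ (X.iCycles_d n _)).Exact :=
    ShortComplex.exact_of_f_is_kernel _ (X.cyclesIsKernel n _ rfl)
  exact (ShortComplex.moduleCat_exact_iff _).1 h x (hx _)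

lemma iCycles_injective (X : ChainComplex (ModuleCat.{u} R) ℕ) (n : ℕ) :
    Function.Injective (X.iCycles n) :=
  (ModuleCat.mono_iff_injective _).1 inferInstance

lemma homologyπ_surjective (X : ChainComplex (ModuleCat.{u} R) ℕ) (n : ℕ) :
    Function.Surjective (X.homologyπ n) :=
  (ModuleCat.epi_iff_surjective _).1 inferInstance

lemma homologyπ_eq_zero_iff (X : ChainComplex (ModuleCat.{u} R) ℕ) {n : ℕ} (c : X.cycles n) :
    X.homologyπ n c = 0 ↔ ∃ b : X.X (n + 1), X.d (n + 1) n b = X.iCycles n c := by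
  have h : (ShortComplex.mk _ _ (X.toCycles_comp_homologyπ (n + 1) n)).Exact :=
    ShortComplex.exact_of_g_is_cokernel _ (X.homologyIsCokernel (n + 1) n (by simp))
  constructor
  · intro hc
    obtain ⟨b, hb⟩ := (ShortComplex.moduleCat_exact_iff _).1 h c hc
    exact ⟨b, by rw [← hb]; exact (ConcreteCategory.congr_hom (X.toCycles_i (n + 1) n) b).symm⟩
  · rintro ⟨b, hb⟩
    have : X.toCycles (n + 1) n b = c := iCycles_injective X n
      ((ConcreteCategory.congr_hom (X.toCycles_i (n + 1) n) b).trans hb)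
    rw [← this]
    exact ConcreteCategory.congr_hom (X.toCycles_comp_homologyπ (n + 1) n) b

/-- A description of quasi-isomorphisms in terms of cycles and boundaries. -/
lemma quasiIso_iff_elements {X Y : ChainComplex (ModuleCat.{u} R) ℕ} (f : X ⟶ Y) :
    QuasiIso f ↔ ∀ n,
      (∀ x : X.X n, IsCycle X x → ∀ y : Y.X (n + 1), Y.d (n + 1) n y = f.f n x →
        ∃ x', X.d (n + 1) n x' = x) ∧
      (∀ y : Y.X n, IsCycle Y y → ∃ x, IsCycle X x ∧ ∃ y', y = f.f n x + Y.d (n + 1) n y') := by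
  have hi : ∀ n (c : X.cycles n),
      Y.iCycles n (HomologicalComplex.cyclesMap f n c) = f.f n (X.iCycles n c) := fun n c =>
    ConcreteCategory.congr_hom (HomologicalComplex.cyclesMap_i f n) c
  have hπ : ∀ n (c : X.cycles n), HomologicalComplex.homologyMap f n (X.homologyπ n c) =
      Y.homologyπ n (HomologicalComplex.cyclesMap f n c) := fun n c =>
    ConcreteCategory.congr_hom (HomologicalComplex.homologyπ_naturality f n) c
  rw [quasiIso_iff]
  refine forall_congr' fun n => ?_
  rw [quasiIsoAt_iff_isIso_homologyMap, ConcreteCategory.isIso_iff_bijective]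
  refine and_congr ?_ ?_
  · rw [injective_iff_map_eq_zero]
    constructor
    · intro h x hx y hy
      obtain ⟨c, rfl⟩ := exists_cycles_of_isCycle X hx
      refine (homologyπ_eq_zero_iff X c).1 (h _ ?_)
      rw [hπ, homologyπ_eq_zero_iff]
      exact ⟨y, by rw [hy, hi]⟩
    · intro h a ha
      obtain ⟨c, rfl⟩ := homologyπ_surjective X n a
      rw [hπ, homologyπ_eq_zero_iff] at ha
      obtain ⟨y, hy⟩ := ha
      exact (homologyπ_eq_zero_iff X c).2 (h _ (isCycle_iCycles X c) y (by rw [hy, hi]))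
  · constructor
    · intro h y hy
      obtain ⟨c, rfl⟩ := exists_cycles_of_isCycle Y hy
      obtain ⟨a, ha⟩ := h (Y.homologyπ n c)
      obtain ⟨c', rfl⟩ := homologyπ_surjective X n a
      rw [hπ, eq_comm, ← sub_eq_zero, ← map_sub, homologyπ_eq_zero_iff] at ha
      obtain ⟨y', hy'⟩ := ha
      refine ⟨_, isCycle_iCycles X c', y', ?_⟩
      rw [hy', map_sub, hi]
      abel
    · intro h b
      obtain ⟨c, rfl⟩ := homologyπ_surjective Y n b
      obtain ⟨x, hx, y', hy'⟩ := h _ (isCycle_iCycles Y c)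
      obtain ⟨c', rfl⟩ := exists_cycles_of_isCycle X hx
      refine ⟨X.homologyπ n c', ?_⟩
      rw [hπ, eq_comm, ← sub_eq_zero, ← map_sub, homologyπ_eq_zero_iff]
      exact ⟨y', by rw [map_sub, hi, hy']; abel⟩

/-- The elementary characterization of trivial fibrations: surjectivity in degree zero, and
every compatible pair of an element of the target and a cycle of the source bounding it lifts. -/
def LiftsBoundaries {X Y : ChainComplex (ModuleCat.{u} R) ℕ} (p : X ⟶ Y) : Prop :=
  Function.Surjective (p.f 0) ∧
    ∀ (n : ℕ) (y : Y.X (n + 1)) (x : X.X n), IsCycle X x → p.f n x = Y.d (n + 1) n y →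
      ∃ x', p.f (n + 1) x' = y ∧ X.d (n + 1) n x' = x

lemma LiftsBoundaries.exists_isCycle {X Y : ChainComplex (ModuleCat.{u} R) ℕ} {p : X ⟶ Y}
    (h : LiftsBoundaries p) {n : ℕ} (y : Y.X n) (hy : IsCycle Y y) :
    ∃ x, IsCycle X x ∧ p.f n x = y := by
  cases n with
  | zero =>
    obtain ⟨x, hx⟩ := h.1 y
    exact ⟨x, isCycle_zero_degree X x, hx⟩
  | succ n =>
    obtain ⟨x, hx, hdx⟩ := h.2 n y 0 (IsCycle.zero X) (by rw [map_zero, hy n])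
    exact ⟨x, (isCycle_succ_iff X x).2 hdx, hx⟩

lemma LiftsBoundaries.surjective {X Y : ChainComplex (ModuleCat.{u} R) ℕ} {p : X ⟶ Y}
    (h : LiftsBoundaries p) (n : ℕ) : Function.Surjective (p.f n) := by
  cases n with
  | zero => exact h.1
  | succ n =>
    intro y
    obtain ⟨x, hx, hpx⟩ := h.exists_isCycle _ (isCycle_d Y (j := n) y)
    obtain ⟨x', hx', -⟩ := h.2 n y x hx hpx
    exact ⟨x', hx'⟩

/-- A map is surjective in positive degrees and a quasi-isomorphism if and only if it lifts
boundaries. -/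
lemma surjective_and_quasiIso_iff {X Y : ChainComplex (ModuleCat.{u} R) ℕ} (p : X ⟶ Y) :
    ((∀ n, 0 < n → Function.Surjective (p.f n)) ∧ QuasiIso p) ↔ LiftsBoundaries p := by
  rw [quasiIso_iff_elements]
  constructor
  · rintro ⟨hs, hq⟩
    refine ⟨fun y => ?_, fun n y x hx hxy => ?_⟩
    · obtain ⟨x, -, y', rfl⟩ := (hq 0).2 y (isCycle_zero_degree Y y)
      obtain ⟨x', rfl⟩ := hs 1 one_pos y'
      exact ⟨x + X.d _ _ x', by rw [map_add, d_f_apply]⟩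
    · obtain ⟨x₁, rfl⟩ := (hq n).1 x hx y hxy.symm
      obtain ⟨z, hz, y', hy'⟩ := (hq (n + 1)).2 (p.f _ x₁ - y) (by
        rw [isCycle_succ_iff, map_sub, d_f_apply, hxy, sub_self])
      obtain ⟨x₂, rfl⟩ := hs (n + 2) (by omega) y'
      refine ⟨x₁ - z - X.d _ _ x₂, ?_, ?_⟩
      · rw [map_sub, map_sub, ← d_f_apply, sub_sub, ← hy']
        abel
      · rw [map_sub, map_sub, hz n, d_d_apply, sub_zero, sub_zero]
  · intro h
    refine ⟨fun n _ => h.surjective n, fun n => ⟨fun x hx y hy => ?_, fun y hy => ?_⟩⟩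
    · obtain ⟨x', -, hx'⟩ := h.2 n y x hx hy.symm
      exact ⟨x', hx'⟩
    · obtain ⟨x, hx, rfl⟩ := h.exists_isCycle y hy
      exact ⟨x, hx, 0, by rw [map_zero, add_zero]⟩

/-- The inclusion of a direct summand with projective complement has the left lifting property
with respect to epimorphisms. -/
lemma llp_epimorphisms_of_decomposition {A B P : ModuleCat.{u} R} [Projective P] {f : A ⟶ B}
    {r : B ⟶ A} {g : B ⟶ P} {s : P ⟶ B} (hr : f ≫ r = 𝟙 A) (hg : f ≫ g = 0)
    (h : r ≫ f + g ≫ s = 𝟙 B) : (MorphismProperty.epimorphisms (ModuleCat.{u} R)).llp f := by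
  intro M N q hq
  have : Epi q := hq
  refine ⟨fun {a b} sq => ⟨⟨⟨r ≫ a + g ≫ Projective.factorThru (s ≫ b) q, ?_, ?_⟩⟩⟩⟩
  · rw [Preadditive.comp_add, reassoc_of% hr, reassoc_of% hg, zero_comp, add_zero]
  · rw [Preadditive.add_comp, Category.assoc, Category.assoc, Projective.factorThru_comp, sq.w,
      ← Category.assoc, ← Category.assoc, ← Preadditive.add_comp, h, Category.id_comp]

open MorphismProperty in
/-- The monomorphisms with projective cokernel are the maps having the left lifting property
with respect to epimorphisms. -/
lemma injective_and_projective_cokernel_iff {A B : ModuleCat.{u} R} (f : A ⟶ B) :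
    (Function.Injective f ∧ Projective (cokernel f)) ↔
      (epimorphisms (ModuleCat.{u} R)).llp f := by
  constructor
  · rintro ⟨hf, hp⟩ M N q hq
    have : Mono f := (ModuleCat.mono_iff_injective _).2 hf
    let S := ShortComplex.mk f (cokernel.π f) (cokernel.condition f)
    have hS : S.ShortExact :=
      { exact := ShortComplex.exact_of_g_is_cokernel _ (cokernelIsCokernel f) }
    have : Projective S.X₃ := hp
    let s := hS.splittingOfProjective
    exact llp_epimorphisms_of_decomposition s.f_r S.zero s.id q hq
  · intro h
    refine ⟨?_, ⟨fun {E X} φ e _ => ?_⟩⟩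
    · have hz : Epi (0 : A ⟶ ModuleCat.of R PUnit) :=
        (ModuleCat.epi_iff_surjective _).2 fun x => ⟨0, Subsingleton.elim _ _⟩
      have := h _ hz
      have sq : CommSq (𝟙 A) f (0 : A ⟶ ModuleCat.of R PUnit) 0 := ⟨by simp⟩
      have : Mono (f ≫ sq.lift) := by
        rw [sq.fac_left]
        infer_instance
      exact (ModuleCat.mono_iff_injective _).1 (mono_of_mono f sq.lift)
    · have := h e ‹Epi e›
      have sq : CommSq 0 f e (cokernel.π f ≫ φ) := ⟨by simp⟩
      refine ⟨cokernel.desc f sq.lift sq.fac_left, ?_⟩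
      rw [← cancel_epi (cokernel.π f), cokernel.π_desc_assoc, sq.fac_right]

/-- The degreewise monomorphisms with degreewise projective cokernel, expressed by lifting. -/
def cofibrations (R : Type u) [Ring R] :
    MorphismProperty (ChainComplex (ModuleCat.{u} R) ℕ) :=
  fun _ _ f => ∀ n, (MorphismProperty.epimorphisms (ModuleCat.{u} R)).llp (f.f n)

lemma cofibrations_iff {X Y : ChainComplex (ModuleCat.{u} R) ℕ} (f : X ⟶ Y) :
    cofibrations R f ↔ (∀ n : ℕ, Function.Injective (f.f n)) ∧
      ∀ n : ℕ, Projective (cokernel (f.f n)) := by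
  rw [← forall_and]
  exact forall_congr' fun n => (injective_and_projective_cokernel_iff (f.f n)).symm

lemma exists_sequence {α : ℕ → Type*} (r : ∀ n, α n → α (n + 1) → Prop) (a : α 0)
    (h : ∀ n x, ∃ y, r n x y) : ∃ s : ∀ n, α n, ∀ n, r n (s n) (s (n + 1)) := by
  choose next hnext using h
  exact ⟨fun n => Nat.rec a next n, fun n => hnext n _⟩

/-- A diagonal in degree `n` of a square, sending boundaries to cycles. -/
def IsPartialLift {A B X Y : ChainComplex (ModuleCat.{u} R) ℕ} (i : A ⟶ B) (p : X ⟶ Y)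
    (a : A ⟶ X) (b : B ⟶ Y) (n : ℕ) (h : B.X n ⟶ X.X n) : Prop :=
  i.f n ≫ h = a.f n ∧ h ≫ p.f n = b.f n ∧ ∀ z : B.X (n + 1), IsCycle X (h (B.d (n + 1) n z))

lemma exists_isPartialLift_succ {A B X Y : ChainComplex (ModuleCat.{u} R) ℕ} {i : A ⟶ B}
    {p : X ⟶ Y} {a : A ⟶ X} {b : B ⟶ Y} (sq : CommSq a i p b) (hi : cofibrations R i)
    (hp : LiftsBoundaries p) {n : ℕ} {h : B.X n ⟶ X.X n} (hh : IsPartialLift i p a b n h) :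
    ∃ h', IsPartialLift i p a b (n + 1) h' ∧ B.d (n + 1) n ≫ h = h' ≫ X.d (n + 1) n := by
  let E : Submodule R (Y.X (n + 1) × X.X n) :=
    { carrier := {e | IsCycle X e.2 ∧ p.f n e.2 = Y.d (n + 1) n e.1}
      add_mem' := fun h₁ h₂ => ⟨h₁.1.add h₂.1, by
        rw [Prod.snd_add, Prod.fst_add, map_add, map_add, h₁.2, h₂.2]⟩
      zero_mem' := ⟨IsCycle.zero X, by simp⟩
      smul_mem' := fun r e he => ⟨fun j => by simp [he.1 j], by
        rw [Prod.smul_snd, Prod.smul_fst, map_smul, map_smul, he.2]⟩ }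
  let q : X.X (n + 1) ⟶ ModuleCat.of R E := ModuleCat.ofHom
    (LinearMap.codRestrict E ((p.f (n + 1)).hom.prod (X.d (n + 1) n).hom) fun x =>
      ⟨isCycle_d X x, (d_f_apply p x).symm⟩)
  have hq : Epi q := by
    rw [ModuleCat.epi_iff_surjective]
    rintro ⟨⟨y, x⟩, hx, hxy⟩
    obtain ⟨x', rfl, rfl⟩ := hp.2 n y x hx hxy
    exact ⟨x', rfl⟩
  have hbp : ∀ z, p.f n (h z) = b.f n z := ConcreteCategory.congr_hom hh.2.1
  let v : B.X (n + 1) ⟶ ModuleCat.of R E := ModuleCat.ofHom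
    (LinearMap.codRestrict E ((b.f (n + 1)).hom.prod (B.d (n + 1) n ≫ h).hom) fun z =>
      ⟨hh.2.2 z, (hbp _).trans (d_f_apply b z).symm⟩)
  have sq' : CommSq (a.f (n + 1)) (i.f (n + 1)) q v := ⟨by
    ext z
    · exact ConcreteCategory.congr_hom (HomologicalComplex.congr_hom sq.w (n + 1)) z
    · change X.d (n + 1) n (a.f (n + 1) z) = h (B.d (n + 1) n (i.f (n + 1) z))
      rw [d_f_apply, d_f_apply]
      exact (ConcreteCategory.congr_hom hh.1 _).symm⟩
  have := hi (n + 1) q hq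
  have hv : ∀ z, q (sq'.lift z) = v z := ConcreteCategory.congr_hom sq'.fac_right
  have hd : ∀ z, X.d (n + 1) n (sq'.lift z) = h (B.d (n + 1) n z) := fun z =>
    congrArg (fun e : E => e.1.2) (hv z)
  refine ⟨sq'.lift, ⟨sq'.fac_left, ?_, fun z => ?_⟩, ?_⟩
  · ext z
    exact congrArg (fun e : E => e.1.1) (hv z)
  · rw [isCycle_succ_iff, hd, d_d_apply, map_zero]
  · ext z
    exact (hd z).symm

/-- Cofibrations have the left lifting property with respect to trivial fibrations. -/
lemma hasLiftingProperty_of_liftsBoundaries {A B X Y : ChainComplex (ModuleCat.{u} R) ℕ}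
    {i : A ⟶ B} {p : X ⟶ Y} (hi : cofibrations R i) (hp : LiftsBoundaries p) :
    HasLiftingProperty i p where
  sq_hasLift {a b} sq := by
    have hp₀ : Epi (p.f 0) := (ModuleCat.epi_iff_surjective _).2 hp.1
    have := hi 0 _ hp₀
    have sq₀ : CommSq (a.f 0) (i.f 0) (p.f 0) (b.f 0) := ⟨HomologicalComplex.congr_hom sq.w 0⟩
    obtain ⟨s, hs⟩ := exists_sequence (α := fun n => {h // IsPartialLift i p a b n h})
      (fun n h h' => B.d (n + 1) n ≫ h.1 = h'.1 ≫ X.d (n + 1) n)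
      ⟨sq₀.lift, sq₀.fac_left, sq₀.fac_right, fun _ => isCycle_zero_degree X _⟩
      (fun n h => by
        obtain ⟨h', hh', hd⟩ := exists_isPartialLift_succ sq hi hp h.2
        exact ⟨⟨h', hh'⟩, hd⟩)
    refine ⟨⟨⟨ChainComplex.ofHom (fun n => (s n).1) fun n => (hs n).symm, ?_, ?_⟩⟩⟩
    · ext n : 1
      exact (s n).2.1
    · ext n : 1
      exact (s n).2.2.1

/-- The contractible (away from degree zero) complex with `P n × P (n + 1)` in degree `n`, whose
differential is the identity of the shared factor. -/
noncomputable def diskSum (P : ℕ → ModuleCat.{u} R) : ChainComplex (ModuleCat.{u} R) ℕ :=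
  ChainComplex.of (fun n => ModuleCat.of R (P n × P (n + 1)))
    (fun _ => ModuleCat.ofHom (LinearMap.inr R _ _ ∘ₗ LinearMap.fst R _ _))
    (fun _ => by
      ext1
      exact LinearMap.ext fun _ => rfl)

lemma diskSum_d_apply (P : ℕ → ModuleCat.{u} R) (n : ℕ) (x : P (n + 1) × P (n + 2)) :
    (diskSum P).d (n + 1) n x = ((0, x.1) : P n × P (n + 1)) :=
  ConcreteCategory.congr_hom (show (diskSum P).d (n + 1) n =
    ModuleCat.ofHom (LinearMap.inr R (P n) (P (n + 1)) ∘ₗ LinearMap.fst R _ _)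
    from ChainComplex.of_d (fun n => ModuleCat.of R (P n × P (n + 1)))
      (fun _ => ModuleCat.ofHom (LinearMap.inr R _ _ ∘ₗ LinearMap.fst R _ _)) n) x

/-- The chain map out of `diskSum P` determined by its restriction to the first factors. -/
noncomputable def diskSumDesc {P : ℕ → ModuleCat.{u} R} {Y : ChainComplex (ModuleCat.{u} R) ℕ}
    (g : ∀ n, P n ⟶ Y.X n) : diskSum P ⟶ Y :=
  ChainComplex.ofHom
    (fun n => ModuleCat.ofHom ((g n).hom.coprod (g (n + 1) ≫ Y.d (n + 1) n).hom)) (fun n => by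
      ext1
      refine LinearMap.ext fun (x : P (n + 1) × P (n + 2)) => ?_
      change Y.d (n + 1) n (g _ x.1 + Y.d _ _ (g _ x.2)) =
        ModuleCat.ofHom ((g n).hom.coprod (g (n + 1) ≫ Y.d (n + 1) n).hom)
          ((diskSum P).d (n + 1) n x)
      rw [diskSum_d_apply]
      change _ = g n 0 + Y.d (n + 1) n (g (n + 1) x.1)
      rw [map_add, d_d_apply, map_zero, add_zero, zero_add])

lemma diskSum_hom_ext {P : ℕ → ModuleCat.{u} R} {Y : ChainComplex (ModuleCat.{u} R) ℕ}
    {φ ψ : diskSum P ⟶ Y}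
    (h : ∀ n (x : P n), φ.f n ((x, 0) : P n × P (n + 1)) = ψ.f n ((x, 0) : P n × P (n + 1))) :
    φ = ψ := by
  ext n : 2
  refine LinearMap.ext fun (x : P n × P (n + 1)) => ?_
  have hx : x = ((x.1, 0) : P n × P (n + 1)) + show P n × P (n + 1) from
      (diskSum P).d (n + 1) n ((x.2, 0) : P (n + 1) × P (n + 2)) := by
    rw [diskSum_d_apply]
    exact Prod.ext (add_zero _).symm (zero_add _).symm
  change φ.f n x = ψ.f n x
  rw [hx]
  refine (map_add (φ.f n).hom _ _).trans (Eq.trans ?_ (map_add (ψ.f n).hom _ _).symm)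
  refine congrArg₂ _ (h n _) ?_
  refine (d_f_apply φ _).symm.trans (Eq.trans ?_ (d_f_apply ψ _))
  exact congrArg _ (h _ _)

lemma diskSum_exists_d_eq {P : ℕ → ModuleCat.{u} R} [Subsingleton (P 0 : Type u)] {n : ℕ}
    (x : (diskSum P).X n) (hx : IsCycle (diskSum P) x) :
    ∃ x', (diskSum P).d (n + 1) n x' = x := by
  have h0 : (show P n × P (n + 1) from x).1 = 0 := by
    cases n with
    | zero => exact Subsingleton.elim (α := P 0) _ _
    | succ n => exact congrArg Prod.snd ((diskSum_d_apply P n x).symm.trans (hx n))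
  refine ⟨((show P n × P (n + 1) from x).2, (0 : P (n + 2))), ?_⟩
  rw [diskSum_d_apply]
  exact Prod.ext h0.symm rfl

instance {P Q : ModuleCat.{u} R} [Projective P] [Projective Q] :
    Projective (ModuleCat.of R (P × Q)) := by
  have := (IsProjective.iff_projective P).2 ‹_›
  have := (IsProjective.iff_projective Q).2 ‹_›
  exact (IsProjective.iff_projective (P × Q)).1 inferInstance

/-- The inclusion of a direct summand with degreewise projective complement is a cofibration. -/
lemma cofibrations_biprod_inl (X D : ChainComplex (ModuleCat.{u} R) ℕ)
    (hD : ∀ n, Projective (D.X n)) : cofibrations R (biprod.inl : X ⟶ X ⊞ D) := by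
  have := hD
  exact fun n => llp_epimorphisms_of_decomposition
    (HomologicalComplex.congr_hom (biprod.inl_fst (X := X) (Y := D)) n)
    (HomologicalComplex.congr_hom (biprod.inl_snd (X := X) (Y := D)) n)
    (HomologicalComplex.congr_hom (biprod.total (X := X) (Y := D)) n)

/-- The inclusion of a direct summand with acyclic complement is a quasi-isomorphism. -/
lemma quasiIso_biprod_inl (X D : ChainComplex (ModuleCat.{u} R) ℕ)
    (hD : ∀ n (x : D.X n), IsCycle D x → ∃ x', D.d (n + 1) n x' = x) :
    QuasiIso (biprod.inl : X ⟶ X ⊞ D) := by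
  have hinl : ∀ n x, (biprod.fst : X ⊞ D ⟶ X).f n ((biprod.inl : X ⟶ X ⊞ D).f n x) = x :=
    fun n x => ConcreteCategory.congr_hom
      (HomologicalComplex.congr_hom (biprod.inl_fst (X := X) (Y := D)) n) x
  have htotal : ∀ n z, (biprod.inl : X ⟶ X ⊞ D).f n ((biprod.fst : X ⊞ D ⟶ X).f n z) +
      (biprod.inr : D ⟶ X ⊞ D).f n ((biprod.snd : X ⊞ D ⟶ D).f n z) = z :=
    fun n z => ConcreteCategory.congr_hom
      (HomologicalComplex.congr_hom (biprod.total (X := X) (Y := D)) n) z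
  rw [quasiIso_iff_elements]
  refine fun n => ⟨fun x _ z hz => ⟨(biprod.fst : X ⊞ D ⟶ X).f _ z, ?_⟩, fun z hz => ?_⟩
  · rw [d_f_apply, hz, hinl]
  · obtain ⟨w, hw⟩ := hD n _ (hz.map (biprod.snd : X ⊞ D ⟶ D))
    refine ⟨_, hz.map (biprod.fst : X ⊞ D ⟶ X), (biprod.inr : D ⟶ X ⊞ D).f _ w, ?_⟩
    rw [d_f_apply, hw, htotal]

lemma hasLiftingProperty_biprod_inl (X : ChainComplex (ModuleCat.{u} R) ℕ)
    (P : ℕ → ModuleCat.{u} R) [Subsingleton (P 0 : Type u)] [∀ n, Projective (P n)]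
    {E B : ChainComplex (ModuleCat.{u} R) ℕ} (p : E ⟶ B)
    (hp : ∀ n, 0 < n → Function.Surjective (p.f n)) :
    HasLiftingProperty (biprod.inl : X ⟶ X ⊞ diskSum P) p where
  sq_hasLift {a b} sq := by
    have hg : ∀ n, ∃ g : P n ⟶ E.X n, ∀ x, p.f n (g x) =
        (biprod.inr ≫ b : diskSum P ⟶ B).f n ((x, 0) : P n × P (n + 1)) := by
      intro n
      cases n with
      | zero =>
        refine ⟨0, fun x => ?_⟩
        rw [Subsingleton.elim x 0]
        exact (map_zero (p.f 0).hom).trans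
          (map_zero ((biprod.inr ≫ b : diskSum P ⟶ B).f 0).hom).symm
      | succ n =>
        have : Epi (p.f (n + 1)) := (ModuleCat.epi_iff_surjective _).2 (hp _ n.succ_pos)
        let φ : P (n + 1) ⟶ B.X (n + 1) :=
          ModuleCat.ofHom (LinearMap.inl R (P (n + 1)) (P (n + 2))) ≫
            (biprod.inr ≫ b : diskSum P ⟶ B).f (n + 1)
        exact ⟨Projective.factorThru φ (p.f (n + 1)),
          ConcreteCategory.congr_hom (Projective.factorThru_comp φ (p.f (n + 1)))⟩
    choose g hg using hg
    have hgb : diskSumDesc g ≫ p = biprod.inr ≫ b := diskSum_hom_ext fun n x => by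
      refine Eq.trans ?_ (hg n x)
      change p.f n (g n x + E.d (n + 1) n (g (n + 1) 0)) = _
      rw [map_zero, map_zero, add_zero]
    refine ⟨⟨⟨biprod.desc a (diskSumDesc g), biprod.inl_desc _ _, ?_⟩⟩⟩
    refine biprod.hom_ext' _ _ ?_ ?_
    · rw [biprod.inl_desc_assoc, sq.w]
    · rw [biprod.inr_desc_assoc, hgb]

/-- A family of projective modules, zero in degree zero and covering `Y` in positive degrees. -/
noncomputable def positiveCover (Y : ChainComplex (ModuleCat.{u} R) ℕ) : ℕ → ModuleCat.{u} R
  | 0 => ModuleCat.of R PUnit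
  | n + 1 => Projective.over (Y.X (n + 1))

/-- The covering maps of `positiveCover`. -/
noncomputable def positiveCoverπ (Y : ChainComplex (ModuleCat.{u} R) ℕ) :
    ∀ n, positiveCover Y n ⟶ Y.X n
  | 0 => 0
  | n + 1 => Projective.π (Y.X (n + 1))

instance (Y : ChainComplex (ModuleCat.{u} R) ℕ) : Subsingleton (positiveCover Y 0 : Type u) :=
  inferInstanceAs (Subsingleton PUnit)

instance (Y : ChainComplex (ModuleCat.{u} R) ℕ) : ∀ n, Projective (positiveCover Y n)
  | 0 => (ModuleCat.isZero_of_subsingleton (positiveCover Y 0)).projective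
  | n + 1 => Projective.projective_over (Y.X (n + 1))

/-- Every map factors as a trivial cofibration having the left lifting property with respect to
fibrations, followed by a fibration. -/
lemma exists_trivialCofibration_fibration_factorization {X Y : ChainComplex (ModuleCat.{u} R) ℕ}
    (f : X ⟶ Y) :
    ∃ (Z : ChainComplex (ModuleCat.{u} R) ℕ) (i : X ⟶ Z) (p : Z ⟶ Y),
      cofibrations R i ∧ QuasiIso i ∧
      (∀ {E B : ChainComplex (ModuleCat.{u} R) ℕ} (q : E ⟶ B),
        (∀ n, 0 < n → Function.Surjective (q.f n)) → HasLiftingProperty i q) ∧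
      (∀ n, 0 < n → Function.Surjective (p.f n)) ∧ i ≫ p = f := by
  let P := positiveCover Y
  let g := positiveCoverπ Y
  refine ⟨X ⊞ diskSum P, biprod.inl, biprod.desc f (diskSumDesc g),
    cofibrations_biprod_inl _ _ fun n =>
      inferInstanceAs (Projective (ModuleCat.of R (P n × P (n + 1)))),
    quasiIso_biprod_inl _ _ fun n => diskSum_exists_d_eq,
    fun q => hasLiftingProperty_biprod_inl X P q, fun n hn y => ?_, biprod.inl_desc _ _⟩
  obtain ⟨n, rfl⟩ := Nat.exists_eq_succ_of_ne_zero hn.ne'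
  obtain ⟨x, rfl⟩ := (ModuleCat.epi_iff_surjective (Projective.π (Y.X (n + 1)))).1 inferInstance y
  refine ⟨(biprod.inr : diskSum P ⟶ X ⊞ diskSum P).f (n + 1)
    ((x, 0) : P (n + 1) × P (n + 2)), ?_⟩
  refine (ConcreteCategory.congr_hom (HomologicalComplex.congr_hom
    (biprod.inr_desc f (diskSumDesc g)) (n + 1)) _).trans ?_
  change g (n + 1) x + Y.d (n + 2) (n + 1) (g (n + 2) 0) = _
  rw [map_zero, map_zero, add_zero]
  rfl

/-- The data in degree `n` from which the next term of a factorization of `f` is built: `C` plays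
the role of the cycles in degree `n - 1` of the intermediate complex. -/
structure FactorizationStage {X Y : ChainComplex (ModuleCat.{u} R) ℕ} (f : X ⟶ Y) (n : ℕ) where
  C : ModuleCat.{u} R
  T : ModuleCat.{u} R
  a : X.X n →ₗ[R] C
  b : C →ₗ[R] T
  t : Y.X n →ₗ[R] T
  w : ∀ x, b (a x) = t (f.f n x)
  d_a : ∀ x, a (X.d (n + 1) n x) = 0

namespace FactorizationStage

variable {X Y : ChainComplex (ModuleCat.{u} R) ℕ} {f : X ⟶ Y} {n : ℕ}
  (S : FactorizationStage f n)

/-- The pairs in `Y.X n × S.C` which agree in `S.T`. -/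
def fiberProduct : Submodule R (Y.X n × S.C) :=
  LinearMap.eqLocus (S.t ∘ₗ LinearMap.fst R _ _) (S.b ∘ₗ LinearMap.snd R _ _)

/-- A projective module covering the fiber product. -/
noncomputable def cover : ModuleCat.{u} R := Projective.over (ModuleCat.of R S.fiberProduct)

instance : Projective S.cover := Projective.projective_over _

/-- The covering map of the fiber product. -/
noncomputable def π : S.cover →ₗ[R] S.fiberProduct :=
  (Projective.π (ModuleCat.of R S.fiberProduct)).hom

lemma π_surjective : Function.Surjective S.π :=
  (ModuleCat.epi_iff_surjective (Projective.π (ModuleCat.of R S.fiberProduct))).1 inferInstance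

/-- The differential of the intermediate complex, with values in `S.C`. -/
noncomputable def δ : (X.X n × S.cover) →ₗ[R] S.C :=
  S.a.coprod (LinearMap.snd R _ _ ∘ₗ S.fiberProduct.subtype ∘ₗ S.π)

/-- The projection of the intermediate complex. -/
noncomputable def p : (X.X n × S.cover) →ₗ[R] Y.X n :=
  (f.f n).hom.coprod (LinearMap.fst R _ _ ∘ₗ S.fiberProduct.subtype ∘ₗ S.π)

lemma p_inl (x : X.X n) : S.p (x, 0) = f.f n x := by
  simp [p]

lemma δ_inl (x : X.X n) : S.δ (x, 0) = S.a x := by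
  simp [δ]

lemma b_δ (z : X.X n × S.cover) : S.b (S.δ z) = S.t (S.p z) := by
  have h : S.t (S.π z.2).1.1 = S.b (S.π z.2).1.2 := (S.π z.2).2
  change S.b (S.a z.1 + (S.π z.2).1.2) = S.t (f.f n z.1 + (S.π z.2).1.1)
  rw [map_add, map_add, S.w, h]

lemma exists_lift (y : Y.X n) (c : S.C) (h : S.t y = S.b c) : ∃ z, S.p z = y ∧ S.δ z = c := by
  obtain ⟨e, he⟩ := S.π_surjective ⟨(y, c), h⟩
  refine ⟨(0, e), ?_, ?_⟩
  · change f.f n 0 + (S.π e).1.1 = y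
    rw [map_zero, zero_add, he]
  · change S.a 0 + (S.π e).1.2 = c
    rw [map_zero, zero_add, he]

/-- The stage following a given one. -/
noncomputable def next : FactorizationStage f (n + 1) where
  C := ModuleCat.of R (LinearMap.ker S.δ)
  T := Y.X n
  a := LinearMap.codRestrict (LinearMap.ker S.δ) (LinearMap.inl R _ _ ∘ₗ (X.d (n + 1) n).hom)
    fun x => (S.δ_inl _).trans (S.d_a x)
  b := S.p ∘ₗ (LinearMap.ker S.δ).subtype
  t := (Y.d (n + 1) n).hom
  w x := (S.p_inl _).trans (d_f_apply f x).symm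
  d_a x := Subtype.ext (Prod.ext (d_d_apply X x) rfl)

end FactorizationStage

section

variable {X Y : ChainComplex (ModuleCat.{u} R) ℕ} (f : X ⟶ Y)

/-- The stages of the factorization of `f` into a cofibration and a trivial fibration. -/
noncomputable def factorizationStage : ∀ n, FactorizationStage f n
  | 0 => { C := ModuleCat.of R PUnit, T := ModuleCat.of R PUnit, a := 0, b := 0, t := 0,
           w := fun _ => rfl, d_a := fun _ => rfl }
  | n + 1 => (factorizationStage n).next

/-- The differential of `factorizationComplex`. -/
noncomputable def factorizationD (n : ℕ) :
    ModuleCat.of R (X.X (n + 1) × (factorizationStage f (n + 1)).cover) ⟶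
      ModuleCat.of R (X.X n × (factorizationStage f n).cover) :=
  ModuleCat.ofHom ((LinearMap.ker (factorizationStage f n).δ).subtype ∘ₗ
    (factorizationStage f (n + 1)).δ)

/-- The intermediate complex of the factorization of `f` into a cofibration and a trivial
fibration. -/
noncomputable def factorizationComplex : ChainComplex (ModuleCat.{u} R) ℕ :=
  ChainComplex.of (fun n => ModuleCat.of R (X.X n × (factorizationStage f n).cover))
    (factorizationD f) fun n => by
      ext1
      refine LinearMap.ext fun z => ?_
      have h := ((factorizationStage f (n + 2)).δ z).2
      exact congrArg Subtype.val h

lemma factorizationComplex_d_apply (n : ℕ)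
    (z : X.X (n + 1) × (factorizationStage f (n + 1)).cover) :
    (factorizationComplex f).d (n + 1) n z =
      ((factorizationStage f (n + 1)).δ z : LinearMap.ker (factorizationStage f n).δ).1 :=
  ConcreteCategory.congr_hom (show (factorizationComplex f).d (n + 1) n = factorizationD f n from
    ChainComplex.of_d (fun n => ModuleCat.of R (X.X n × (factorizationStage f n).cover))
      (factorizationD f) n) z

/-- The cofibration in the factorization of `f`. -/
noncomputable def factorizationι : X ⟶ factorizationComplex f :=
  ChainComplex.ofHom (fun n => ModuleCat.ofHom (LinearMap.inl R _ _)) fun n => by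
    ext x
    refine (factorizationComplex_d_apply f n _).trans ?_
    exact congrArg (fun c : LinearMap.ker (factorizationStage f n).δ => c.1)
      ((factorizationStage f (n + 1)).δ_inl x)

/-- The trivial fibration in the factorization of `f`. -/
noncomputable def factorizationπ : factorizationComplex f ⟶ Y :=
  ChainComplex.ofHom (fun n => ModuleCat.ofHom (factorizationStage f n).p) fun n => by
    ext1
    refine LinearMap.ext fun z => ?_
    refine ((factorizationStage f (n + 1)).b_δ z).symm.trans ?_
    exact congrArg (factorizationStage f n).p (factorizationComplex_d_apply f n z).symm

lemma factorizationι_π : factorizationι f ≫ factorizationπ f = f := by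
  ext n x
  exact (factorizationStage f n).p_inl x

lemma cofibrations_factorizationι : cofibrations R (factorizationι f) := by
  intro n
  refine llp_epimorphisms_of_decomposition (P := (factorizationStage f n).cover)
    (f := ModuleCat.ofHom (LinearMap.inl R (X.X n) (factorizationStage f n).cover))
    (r := ModuleCat.ofHom (LinearMap.fst R (X.X n) (factorizationStage f n).cover))
    (g := ModuleCat.ofHom (LinearMap.snd R (X.X n) (factorizationStage f n).cover))
    (s := ModuleCat.ofHom (LinearMap.inr R (X.X n) (factorizationStage f n).cover)) rfl rfl ?_
  ext1
  exact LinearMap.ext fun z => Prod.ext (add_zero _) (zero_add _)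

lemma factorizationStage_δ_eq_zero (n : ℕ) (z : (factorizationComplex f).X n)
    (hz : IsCycle (factorizationComplex f) z) : (factorizationStage f n).δ z = 0 := by
  cases n with
  | zero => rfl
  | succ n => exact Subtype.ext ((factorizationComplex_d_apply f n z).symm.trans (hz n))

lemma liftsBoundaries_factorizationπ : LiftsBoundaries (factorizationπ f) := by
  refine ⟨fun y => ?_, fun n y z hz hzy => ?_⟩
  · obtain ⟨z, hz, -⟩ := (factorizationStage f 0).exists_lift y 0 rfl
    exact ⟨z, hz⟩
  · obtain ⟨z', hz', hdz'⟩ := (factorizationStage f (n + 1)).exists_lift y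
      ⟨z, factorizationStage_δ_eq_zero f n z hz⟩ hzy.symm
    refine ⟨z', hz', (factorizationComplex_d_apply f n z').trans ?_⟩
    rw [hdz']

end

open ZeroObject

/-- The sphere complex: `R` concentrated in degree `n`. -/
noncomputable def sphere (R : Type u) [Ring R] (n : ℕ) : ChainComplex (ModuleCat.{u} R) ℕ :=
  (HomologicalComplex.single _ _ n).obj (ModuleCat.of R R)

/-- The disk complex: the identity of `R` from degree `n + 1` to degree `n`. -/
noncomputable def disk (R : Type u) [Ring R] (n : ℕ) : ChainComplex (ModuleCat.{u} R) ℕ :=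
  HomologicalComplex.double (𝟙 (ModuleCat.of R R)) (ComplexShape.down_mk (n + 1) n rfl)

/-- The generator of `sphere R n`. -/
noncomputable def sphereGenerator (R : Type u) [Ring R] (n : ℕ) : (sphere R n).X n :=
  (HomologicalComplex.singleObjXSelf (ComplexShape.down ℕ) n (ModuleCat.of R R)).inv (1 : R)

/-- The generator of `disk R n` in degree `n + 1`. -/
noncomputable def diskGenerator (R : Type u) [Ring R] (n : ℕ) : (disk R n).X (n + 1) :=
  (HomologicalComplex.doubleXIso₀ (𝟙 (ModuleCat.of R R))
    (ComplexShape.down_mk (n + 1) n rfl)).inv (1 : R)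

lemma isCycle_sphereGenerator (n : ℕ) : IsCycle (sphere R n) (sphereGenerator R n) := fun _ => rfl

/-- Maps out of a sphere classify cycles. -/
lemma existsUnique_sphere_hom {X : ChainComplex (ModuleCat.{u} R) ℕ} {n : ℕ} (x : X.X n)
    (hx : IsCycle X x) : ∃! φ : sphere R n ⟶ X, φ.f n (sphereGenerator R n) = x := by
  let e := HomologicalComplex.singleObjXSelf (ComplexShape.down ℕ) n (ModuleCat.of R R)
  let f : ModuleCat.of R R ⟶ X.X n := ModuleCat.ofHom (LinearMap.toSpanSingleton R _ x)
  have hf : ∀ k, (ComplexShape.down ℕ).Rel n k → f ≫ X.d n k = 0 := fun k _ => by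
    ext
    change X.d n k ((1 : R) • x) = 0
    rw [one_smul, hx k]
  refine ⟨HomologicalComplex.mkHomFromSingle f hf, ?_, fun ψ hψ => ?_⟩
  · have h : e.inv ≫ (HomologicalComplex.mkHomFromSingle f hf).f n = f := by
      rw [HomologicalComplex.mkHomFromSingle_f, Iso.inv_hom_id_assoc]
    exact (ConcreteCategory.congr_hom h (1 : R)).trans (one_smul R x)
  · refine HomologicalComplex.from_single_hom_ext ?_
    rw [HomologicalComplex.mkHomFromSingle_f, ← Iso.inv_comp_eq]
    ext
    exact hψ.trans (one_smul R x).symm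

/-- Maps out of a disk classify elements. -/
lemma existsUnique_disk_hom {X : ChainComplex (ModuleCat.{u} R) ℕ} {n : ℕ} (x : X.X (n + 1)) :
    ∃! φ : disk R n ⟶ X, φ.f (n + 1) (diskGenerator R n) = x := by
  let E : (disk R n ⟶ X) ≃ (ModuleCat.of R R ⟶ X.X (n + 1)) :=
    (HomologicalComplex.evalCompCoyonedaCorepresentableByDoubleId
      (ComplexShape.down_mk (n + 1) n rfl) n.succ_ne_self (ModuleCat.of R R)).homEquiv
  let f : ModuleCat.of R R ⟶ X.X (n + 1) := ModuleCat.ofHom (LinearMap.toSpanSingleton R _ x)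
  refine ⟨E.symm f, ?_, fun ψ hψ => E.eq_symm_apply.2 ?_⟩
  · exact (ConcreteCategory.congr_hom (E.apply_symm_apply f) (1 : R)).trans (one_smul R x)
  · ext
    exact Eq.trans hψ (one_smul R x).symm

/-- The inclusion of the boundary sphere of a disk. -/
noncomputable def sphereInclusion (R : Type u) [Ring R] (n : ℕ) : sphere R n ⟶ disk R n :=
  (existsUnique_sphere_hom _ (isCycle_d (disk R n) (j := n) (diskGenerator R n))).choose

lemma sphereInclusion_f_generator (n : ℕ) :
    (sphereInclusion R n).f n (sphereGenerator R n) =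
      (disk R n).d (n + 1) n (diskGenerator R n) :=
  (existsUnique_sphere_hom _
    (isCycle_d (disk R n) (j := n) (diskGenerator R n))).choose_spec.1

lemma sphere_hom_ext {X : ChainComplex (ModuleCat.{u} R) ℕ} {n : ℕ} {φ ψ : sphere R n ⟶ X}
    (h : φ.f n (sphereGenerator R n) = ψ.f n (sphereGenerator R n)) : φ = ψ :=
  (existsUnique_sphere_hom _ ((isCycle_sphereGenerator n).map ψ)).unique h rfl

lemma disk_hom_ext {X : ChainComplex (ModuleCat.{u} R) ℕ} {n : ℕ} {φ ψ : disk R n ⟶ X}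
    (h : φ.f (n + 1) (diskGenerator R n) = ψ.f (n + 1) (diskGenerator R n)) : φ = ψ :=
  (existsUnique_disk_hom _).unique h rfl

/-- The generating trivial cofibrations: the maps from zero to the disks. -/
noncomputable def generatingTrivialCofibrations (R : Type u) [Ring R] :
    MorphismProperty (ChainComplex (ModuleCat.{u} R) ℕ) :=
  MorphismProperty.ofHoms fun n => (0 : 0 ⟶ disk R n)

/-- The generating cofibrations: the inclusions of spheres into disks, together with the map from
zero to the sphere in degree zero. -/
inductive generatingCofibrations (R : Type u) [Ring R] :
    MorphismProperty (ChainComplex (ModuleCat.{u} R) ℕ)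
  | zero_sphere : generatingCofibrations R (0 : 0 ⟶ sphere R 0)
  | sphereInclusion (n : ℕ) : generatingCofibrations R (sphereInclusion R n)

section

variable {X Y : ChainComplex (ModuleCat.{u} R) ℕ} (p : X ⟶ Y)

lemma hasLiftingProperty_zero_disk_iff (n : ℕ) :
    HasLiftingProperty (0 : 0 ⟶ disk R n) p ↔ Function.Surjective (p.f (n + 1)) := by
  constructor
  · intro _ y
    obtain ⟨b, rfl, -⟩ := existsUnique_disk_hom y
    have sq : CommSq 0 (0 : 0 ⟶ disk R n) p b := ⟨by simp⟩
    exact ⟨sq.lift.f _ (diskGenerator R n), ConcreteCategory.congr_hom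
      (HomologicalComplex.congr_hom sq.fac_right (n + 1)) _⟩
  · refine fun h => ⟨fun {a b} _ => ?_⟩
    obtain ⟨x, hx⟩ := h (b.f _ (diskGenerator R n))
    obtain ⟨l, rfl, -⟩ := existsUnique_disk_hom x
    exact ⟨⟨⟨l, (isZero_zero _).eq_of_src _ _, disk_hom_ext hx⟩⟩⟩

lemma hasLiftingProperty_zero_sphere_iff :
    HasLiftingProperty (0 : 0 ⟶ sphere R 0) p ↔ Function.Surjective (p.f 0) := by
  constructor
  · intro _ y
    obtain ⟨b, rfl, -⟩ := existsUnique_sphere_hom y (isCycle_zero_degree Y y)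
    have sq : CommSq 0 (0 : 0 ⟶ sphere R 0) p b := ⟨by simp⟩
    exact ⟨sq.lift.f _ (sphereGenerator R 0), ConcreteCategory.congr_hom
      (HomologicalComplex.congr_hom sq.fac_right 0) _⟩
  · refine fun h => ⟨fun {a b} _ => ?_⟩
    obtain ⟨x, hx⟩ := h (b.f _ (sphereGenerator R 0))
    obtain ⟨l, rfl, -⟩ := existsUnique_sphere_hom x (isCycle_zero_degree X x)
    exact ⟨⟨⟨l, (isZero_zero _).eq_of_src _ _, sphere_hom_ext hx⟩⟩⟩

lemma hasLiftingProperty_sphereInclusion_iff (n : ℕ) :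
    HasLiftingProperty (sphereInclusion R n) p ↔
      ∀ (y : Y.X (n + 1)) (x : X.X n), IsCycle X x → p.f n x = Y.d (n + 1) n y →
        ∃ x', p.f (n + 1) x' = y ∧ X.d (n + 1) n x' = x := by
  have comp_apply {Z : ChainComplex (ModuleCat.{u} R) ℕ} (l : disk R n ⟶ Z) :
      (sphereInclusion R n ≫ l).f n (sphereGenerator R n) =
        Z.d (n + 1) n (l.f (n + 1) (diskGenerator R n)) := by
    rw [d_f_apply, ← sphereInclusion_f_generator]
    rfl
  constructor
  · intro _ y x hx hxy
    obtain ⟨b, rfl, -⟩ := existsUnique_disk_hom y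
    obtain ⟨a, rfl, -⟩ := existsUnique_sphere_hom x hx
    have sq : CommSq a (sphereInclusion R n) p b :=
      ⟨sphere_hom_ext (hxy.trans (comp_apply b).symm)⟩
    refine ⟨sq.lift.f _ (diskGenerator R n), ConcreteCategory.congr_hom
      (HomologicalComplex.congr_hom sq.fac_right (n + 1)) _, ?_⟩
    rw [← comp_apply, sq.fac_left]
  · refine fun h => ⟨fun {a b} sq => ?_⟩
    obtain ⟨x', hx', hdx'⟩ := h (b.f _ (diskGenerator R n)) (a.f _ (sphereGenerator R n))
      ((isCycle_sphereGenerator n).map a) ((ConcreteCategory.congr_hom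
        (HomologicalComplex.congr_hom sq.w n) (sphereGenerator R n)).trans (comp_apply b))
    obtain ⟨l, rfl, -⟩ := existsUnique_disk_hom x'
    exact ⟨⟨⟨l, sphere_hom_ext ((comp_apply l).trans hdx'), disk_hom_ext hx'⟩⟩⟩

lemma rlpOf_generatingTrivialCofibrations_iff :
    rlpOf (generatingTrivialCofibrations R) p ↔ ∀ n, 0 < n → Function.Surjective (p.f n) := by
  constructor
  · rintro h (_ | n) hn
    · exact absurd hn (lt_irrefl 0)
    · exact (hasLiftingProperty_zero_disk_iff p n).1 (h _ ⟨n⟩)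
  · rintro h _ _ _ ⟨n⟩
    exact (hasLiftingProperty_zero_disk_iff p n).2 (h _ n.succ_pos)

lemma rlpOf_generatingCofibrations_iff :
    rlpOf (generatingCofibrations R) p ↔ LiftsBoundaries p := by
  constructor
  · exact fun h => ⟨(hasLiftingProperty_zero_sphere_iff p).1 (h _ .zero_sphere), fun n =>
      (hasLiftingProperty_sphereInclusion_iff p n).1 (h _ (.sphereInclusion n))⟩
  · rintro h _ _ _ (_ | n)
    · exact (hasLiftingProperty_zero_sphere_iff p).2 h.1
    · exact (hasLiftingProperty_sphereInclusion_iff p n).2 (h.2 n)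

end

lemma _root_.IsRetractOf.nonempty_retractArrow {C : Type*} [Category* C] {X Y A B : C} {g : X ⟶ Y}
    {f : A ⟶ B} (h : IsRetractOf g f) : Nonempty (RetractArrow g f) := by
  obtain ⟨i, r, j, s, hir, hjs, hi, hr⟩ := h
  exact ⟨{ i := Arrow.homMk i j hi, r := Arrow.homMk r s hr.symm,
           retract := by ext <;> assumption }⟩

instance : (cofibrations R).IsStableUnderRetracts where
  of_retract h hf n := MorphismProperty.of_retract
    (h.map (HomologicalComplex.eval _ _ n)) (hf n)

lemma surjective_of_retractArrow {X Y A B : ChainComplex (ModuleCat.{u} R) ℕ} {g : X ⟶ Y}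
    {f : A ⟶ B} (h : RetractArrow g f) {n : ℕ} (hf : Function.Surjective (f.f n)) :
    Function.Surjective (g.f n) := by
  have h' : RetractArrow (g.f n) (f.f n) := h.map (HomologicalComplex.eval _ _ n)
  rw [← ModuleCat.epi_iff_surjective] at hf ⊢
  exact MorphismProperty.of_retract (P := MorphismProperty.epimorphisms _) h' hf

/-- Trivial cofibrations have the left lifting property with respect to fibrations. -/
lemma hasLiftingProperty_of_quasiIso {A B X Y : ChainComplex (ModuleCat.{u} R) ℕ} {i : A ⟶ B}
    {p : X ⟶ Y} (hi : cofibrations R i) [QuasiIso i]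
    (hp : ∀ n, 0 < n → Function.Surjective (p.f n)) : HasLiftingProperty i p := by
  obtain ⟨Z, j, q, -, hj, hjl, hq, rfl⟩ := exists_trivialCofibration_fibration_factorization i
  have hqq : QuasiIso q := quasiIso_of_comp_left j q
  have := hasLiftingProperty_of_liftsBoundaries hi ((surjective_and_quasiIso_iff q).1 ⟨hq, hqq⟩)
  have := hjl p hp
  exact (RetractArrow.ofLeftLiftingProperty (f := j ≫ q) rfl).leftLiftingProperty p

/-- The projective model structure on nonnegatively graded chain complexes. -/
def projectiveModelStructure (R : Type u) [Ring R] :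
    ModelStructure (ChainComplex (ModuleCat.{u} R) ℕ) where
  weq _ _ f := QuasiIso f
  fib _ _ f := ∀ n, 0 < n → Function.Surjective (f.f n)
  cof := cofibrations R
  weq_of_iso _ _ := inferInstance
  weq_comp _ _ _ _ := inferInstance
  weq_of_comp_left f g _ _ := quasiIso_of_comp_left f g
  weq_of_comp_right f g _ _ := quasiIso_of_comp_right f g
  weq_retract _ _ h _ := quasiIso_of_retractArrow h.nonempty_retractArrow.some
  fib_retract _ _ h hf n hn := surjective_of_retractArrow h.nonempty_retractArrow.some (hf n hn)
  cof_retract _ _ h := MorphismProperty.of_retract h.nonempty_retractArrow.some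
  lift_cof_trivFib _ p hi hp hw :=
    hasLiftingProperty_of_liftsBoundaries hi ((surjective_and_quasiIso_iff p).1 ⟨hp, hw⟩)
  lift_trivCof_fib _ _ hi _ hp := hasLiftingProperty_of_quasiIso hi hp
  fact_trivCof_fib f := by
    obtain ⟨Z, i, p, hi, hw, -, hp, h⟩ := exists_trivialCofibration_fibration_factorization f
    exact ⟨Z, i, p, hi, hw, hp, h⟩
  fact_cof_trivFib f := by
    obtain ⟨hp, hw⟩ := (surjective_and_quasiIso_iff _).2 (liftsBoundaries_factorizationπ f)
    exact ⟨_, _, _, cofibrations_factorizationι f, hp, hw, factorizationι_π f⟩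

lemma isCofibrantlyGenerated_projectiveModelStructure :
    IsCofibrantlyGenerated (projectiveModelStructure R) (generatingCofibrations R)
      (generatingTrivialCofibrations R) where
  fib_iff p := (rlpOf_generatingTrivialCofibrations_iff p).symm
  trivFib_iff p := (surjective_and_quasiIso_iff p).trans (rlpOf_generatingCofibrations_iff p).symm

end ProjectiveModelStructure

/-- For any unital ring `R`, the category `Ch₊(R)` of non-negatively graded
chain complexes of left `R`-modules carries a cofibrantly generated model structure in which
the weak equivalences are the quasi-isomorphisms, the fibrations are the chain maps that are
surjective in all strictly positive degrees, and the cofibrations are the injective chain maps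
with degree-wise projective cokernel. -/
theorem projective_model_structure_on_nonneg_chain_complexes
    (R : Type u) [Ring R] :
    ∃ M : ModelStructure (ChainComplex (ModuleCat.{u} R) ℕ),
      (∀ {X Y : ChainComplex (ModuleCat.{u} R) ℕ} (f : X ⟶ Y), M.weq f ↔ QuasiIso f) ∧
      (∀ {X Y : ChainComplex (ModuleCat.{u} R) ℕ} (f : X ⟶ Y),
        M.fib f ↔ ∀ n : ℕ, 0 < n → Function.Surjective (f.f n)) ∧
      (∀ {X Y : ChainComplex (ModuleCat.{u} R) ℕ} (f : X ⟶ Y),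
        M.cof f ↔ (∀ n : ℕ, Function.Injective (f.f n)) ∧
          ∀ n : ℕ, Projective (cokernel (f.f n))) ∧
      ∃ I J : MorphismProperty (ChainComplex (ModuleCat.{u} R) ℕ),
        IsCofibrantlyGenerated M I J := by
  exact ⟨ProjectiveModelStructure.projectiveModelStructure R, fun _ => Iff.rfl, fun _ => Iff.rfl,
    ProjectiveModelStructure.cofibrations_iff, _, _,
    ProjectiveModelStructure.isCofibrantlyGenerated_projectiveModelStructure⟩
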